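/- Let P = (X,≺) be a finite poset with n elements, z₁ ≺ z₂ ≺ z₃ distinct, and suppose F(k,ℓ)·F(k+1,ℓ+1) > 0. Then F(k+1,ℓ)·F(k,ℓ+1) ≤ 2kℓ(min{k,ℓ}+1)·n · F(k,ℓ)·F(k+1,ℓ+1). -/

import Mathlib

/-- The number of linear extensions `L` of a finite poset `X`
(order-preserving bijections `X ≃ Fin (card X)`) such that
`L z₂ − L z₁ = k` and `L z₃ − L z₂ = l`. -/
noncomputable def F (X : Type) [PartialOrder X] [Fintype X] (z₁ z₂ z₃ : X) (k l : ℕ) : ℕ :=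
  Nat.card {L : X ≃ Fin (Fintype.card X) // (∀ a b : X, a < b → L a < L b) ∧
    (L z₂ : ℕ) = (L z₁ : ℕ) + k ∧ (L z₃ : ℕ) = (L z₂ : ℕ) + l}

/-- Relocate the entry in position `i` to position `j`, shifting the positions in between. -/
def relocate (i j x : ℕ) : ℕ :=
  if x = i then j
  else if i < x ∧ x ≤ j then x - 1
  else if j ≤ x ∧ x < i then x + 1
  else x

lemma relocate_leftInverse (i j : ℕ) : Function.LeftInverse (relocate j i) (relocate i j) := by
  intro x
  unfold relocate
  split_ifs <;> omega

lemma relocate_comp_eq {X : Type} {f g : X → ℕ} {i j i' j' : ℕ} (hg : g = relocate i j ∘ f)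
    (hi : i' = i) (hj : j' = j) : relocate j' i' ∘ g = f := by
  subst hg hi hj
  exact funext fun x => relocate_leftInverse _ _ _

lemma relocate_relocate_comp_eq {X : Type} {f g : X → ℕ} {i j i' j' a b a' b' : ℕ}
    (hg : g = relocate a b ∘ relocate i j ∘ f)
    (hi : i' = i) (hj : j' = j) (ha : a' = a) (hb : b' = b) :
    relocate j' i' ∘ relocate b' a' ∘ g = f := by
  rw [relocate_comp_eq hg ha hb]
  exact relocate_comp_eq rfl hi hj

/-- A linear extension of `X`, viewed as an injective map to `{0, …, card X - 1}`. -/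
structure IsLinearExtension {X : Type} [PartialOrder X] [Fintype X] (f : X → ℕ) : Prop where
  inj : Function.Injective f
  lt_card : ∀ x, f x < Fintype.card X
  mono : ∀ a b, a < b → f a < f b

/-- The linear extensions with gaps `k` from `z₁` to `z₂` and `l` from `z₂` to `z₃`. -/
def gapSet (X : Type) [PartialOrder X] [Fintype X] (z₁ z₂ z₃ : X) (k l : ℕ) : Set (X → ℕ) :=
  {f | IsLinearExtension f ∧ f z₂ = f z₁ + k ∧ f z₃ = f z₂ + l}

section

variable {X : Type} [PartialOrder X] [Fintype X]

noncomputable def linearExtensionEquivGapSet (z₁ z₂ z₃ : X) (k l : ℕ) :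
    {L : X ≃ Fin (Fintype.card X) // (∀ a b : X, a < b → L a < L b) ∧
      (L z₂ : ℕ) = (L z₁ : ℕ) + k ∧ (L z₃ : ℕ) = (L z₂ : ℕ) + l} ≃
      gapSet X z₁ z₂ z₃ k l where
  toFun L := ⟨fun x => L.1 x,
    ⟨fun _ _ h => L.1.injective (Fin.ext h), fun x => (L.1 x).2, fun a b h => L.2.1 a b h⟩,
    L.2.2⟩
  invFun f := ⟨Equiv.ofBijective (fun x => ⟨f.1 x, f.2.1.lt_card x⟩)
    ((Fintype.bijective_iff_injective_and_card _).2
      ⟨fun _ _ h => f.2.1.inj (congrArg Fin.val h), by simp⟩),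
    fun a b h => f.2.1.mono a b h, f.2.2⟩
  left_inv L := by ext; rfl
  right_inv f := by ext; rfl

lemma F_eq_ncard (z₁ z₂ z₃ : X) (k l : ℕ) :
    F X z₁ z₂ z₃ k l = (gapSet X z₁ z₂ z₃ k l).ncard :=
  Nat.card_congr (linearExtensionEquivGapSet z₁ z₂ z₃ k l)

lemma gapSet_finite (z₁ z₂ z₃ : X) (k l : ℕ) : (gapSet X z₁ z₂ z₃ k l).Finite :=
  haveI := Finite.of_equiv _ (linearExtensionEquivGapSet z₁ z₂ z₃ k l)
  Set.toFinite _

lemma exists_mem_gapSet {z₁ z₂ z₃ : X} {k l : ℕ} (h : 0 < F X z₁ z₂ z₃ k l) :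
    ∃ f, f ∈ gapSet X z₁ z₂ z₃ k l := by
  rw [F_eq_ncard] at h
  exact Set.nonempty_of_ncard_ne_zero h.ne'

namespace IsLinearExtension

variable {f g : X → ℕ}

lemma exists_eq (hf : IsLinearExtension f) {i : ℕ} (hi : i < Fintype.card X) :
    ∃ x, f x = i := by
  have hb : Function.Bijective (fun x => (⟨f x, hf.lt_card x⟩ : Fin (Fintype.card X))) :=
    (Fintype.bijective_iff_injective_and_card _).2
      ⟨fun _ _ h => hf.inj (congrArg Fin.val h), by simp⟩
  obtain ⟨x, hx⟩ := hb.2 ⟨i, hi⟩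
  exact ⟨x, congrArg Fin.val hx⟩

lemma gap_le_gap (hf : IsLinearExtension f) (hg : IsLinearExtension g) {a b : X} (hab : a < b)
    (h : ∀ w, f a < f w → f w < f b → g a < g w ∧ g w < g b) :
    f b - f a ≤ g b - g a := by
  have hsub : Finset.Ioo (f a) (f b) ⊆
      ((Finset.univ.filter fun w => f a < f w ∧ f w < f b).image f) := by
    intro i hi
    rw [Finset.mem_Ioo] at hi
    obtain ⟨x, rfl⟩ := hf.exists_eq (hi.2.trans (hf.lt_card b))
    simp only [Finset.mem_image, Finset.mem_filter, Finset.mem_univ, true_and]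
    exact ⟨x, hi, rfl⟩
  have h₁ := (Finset.card_le_card hsub).trans Finset.card_image_le
  have h₂ : (Finset.univ.filter fun w => f a < f w ∧ f w < f b).card ≤
      (Finset.Ioo (g a) (g b)).card := by
    refine Finset.card_le_card_of_injOn g (fun w hw => ?_) hg.inj.injOn
    simp only [Finset.coe_filter, Finset.mem_univ, true_and, Set.mem_ofPred_eq] at hw
    simpa using h w hw.1 hw.2
  have h₃ := h₁.trans h₂
  have := hg.mono a b hab
  have := hf.mono a b hab
  simp only [Nat.card_Ioo] at h₃
  omega

lemma relocate_comp (hf : IsLinearExtension f) (x z : X)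
    (hup : ∀ w, f x < f w → f w ≤ f z → ¬ x < w)
    (hdown : ∀ w, f z ≤ f w → f w < f x → ¬ w < x) :
    IsLinearExtension (relocate (f x) (f z) ∘ f) where
  inj := (relocate_leftInverse _ _).injective.comp hf.inj
  lt_card y := by
    have := hf.lt_card x
    have := hf.lt_card y
    have := hf.lt_card z
    simp only [Function.comp_apply, relocate]
    split_ifs <;> omega
  mono a b hab := by
    have h := hf.mono a b hab
    have ha : ¬ (f a = f x ∧ f b ≤ f z) := fun ⟨e, h'⟩ => by
      obtain rfl := hf.inj e
      exact hup b h h' hab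
    have hb : ¬ (f b = f x ∧ f z ≤ f a) := fun ⟨e, h'⟩ => by
      obtain rfl := hf.inj e
      exact hdown a h' h hab
    simp only [Function.comp_apply, relocate]
    split_ifs <;> omega

/-- The first entry after `z` that is not above `z` can be relocated to just before `z`. -/
lemma exists_relocate_before (hf : IsLinearExtension f) {z y : X} (hy : f z < f y)
    (hzy : ¬ z < y) :
    ∃ x, f z < f x ∧ f x ≤ f y ∧ ¬ z < x ∧ IsLinearExtension (relocate (f x) (f z) ∘ f) := by
  obtain ⟨x, ⟨hx, hzx⟩, hmin⟩ := Set.exists_min_image {w | f z < f w ∧ ¬ z < w} f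
    (Set.toFinite _) ⟨y, hy, hzy⟩
  refine ⟨x, hx, hmin y ⟨hy, hzy⟩, hzx, hf.relocate_comp x z (by omega) fun w h₁ h₂ hwx => ?_⟩
  rcases h₁.eq_or_lt with h | h
  · exact hzx (hf.inj h ▸ hwx)
  · have hzw : z < w := by
      by_contra hzw
      exact absurd (hmin w ⟨h, hzw⟩) (by omega)
    exact hzx (hzw.trans hwx)

/-- The last entry before `z` that is not below `z` can be relocated to just after `z`. -/
lemma exists_relocate_after (hf : IsLinearExtension f) {z y : X} (hy : f y < f z)
    (hyz : ¬ y < z) :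
    ∃ x, f x < f z ∧ f y ≤ f x ∧ ¬ x < z ∧ IsLinearExtension (relocate (f x) (f z) ∘ f) := by
  obtain ⟨x, ⟨hx, hxz⟩, hmax⟩ := Set.exists_max_image {w | f w < f z ∧ ¬ w < z} f
    (Set.toFinite _) ⟨y, hy, hyz⟩
  refine ⟨x, hx, hmax y ⟨hy, hyz⟩, hxz, hf.relocate_comp x z (fun w h₁ h₂ hxw => ?_) (by omega)⟩
  rcases h₂.eq_or_lt with h | h
  · exact hxz (hf.inj h ▸ hxw)
  · have hwz : w < z := by
      by_contra hwz
      exact absurd (hmax w ⟨h, hwz⟩) (by omega)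
    exact hxz (hxw.trans hwz)

end IsLinearExtension

lemma F_le_card_mul {C : Type} [Finite C] {z₁ z₂ z₃ : X} {k l k' l' : ℕ}
    (G : (X → ℕ) → C → X → ℕ)
    (h : ∀ f ∈ gapSet X z₁ z₂ z₃ k l, ∃ g ∈ gapSet X z₁ z₂ z₃ k' l', ∃ c, G g c = f) :
    F X z₁ z₂ z₃ k l ≤ Nat.card C * F X z₁ z₂ z₃ k' l' := by
  have hfin := (gapSet_finite z₁ z₂ z₃ k' l').prod (Set.finite_univ (α := C))
  rw [F_eq_ncard, F_eq_ncard, mul_comm, ← Set.ncard_univ C, ← Set.ncard_prod]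
  refine (Set.ncard_le_ncard (t := (fun p : (X → ℕ) × C => G p.1 p.2) '' _) ?_
    (hfin.image _)).trans (Set.ncard_image_le hfin)
  intro f hf
  obtain ⟨g, hg, c, rfl⟩ := h f hf
  exact ⟨(g, c), ⟨hg, Set.mem_univ _⟩, rfl⟩

/-- Undoes the relocations that shorten the gap between `z₁` and `z₂`. -/
def widenFirstGap (z₁ z₂ z₃ : X) (k l : ℕ) (g : X → ℕ) (c : Bool × Fin k × Fin l) : X → ℕ :=
  if c.1 then
    if (c.2.2 : ℕ) + 1 = l then relocate (g z₃ + 1) (g z₁ + 1 + c.2.1) ∘ g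
    else relocate (g z₃ + 1) (g z₂ + 2 + c.2.2) ∘ relocate (g z₂ + 1) (g z₁ + 1 + c.2.1) ∘ g
  else
    if (c.2.2 : ℕ) + 1 = l then relocate (g z₁ - 1) (g z₁ + c.2.1) ∘ g
    else relocate (g z₁ - 1) (g z₂ + 1 + c.2.2) ∘ relocate (g z₂ + 1) (g z₁ + 1 + c.2.1) ∘ g

lemma F_succ_left_le {z₁ z₂ z₃ : X} (h12 : z₁ < z₂) (h23 : z₂ < z₃) {k l : ℕ}
    (hl : 1 ≤ l) (hpos : 0 < F X z₁ z₂ z₃ k l) :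
    F X z₁ z₂ z₃ (k + 1) l ≤ 2 * k * l * F X z₁ z₂ z₃ k l := by
  obtain ⟨e, he, he₂, he₃⟩ := exists_mem_gapSet hpos
  have hC : Nat.card (Bool × Fin k × Fin l) = 2 * k * l := by simp [mul_assoc]
  rw [← hC]
  refine F_le_card_mul (widenFirstGap z₁ z₂ z₃ k l) ?_
  rintro f ⟨hf, hf₂, hf₃⟩
  by_cases hA : ∃ y, f z₁ < f y ∧ f y < f z₂ ∧ ¬ z₁ < y
  · obtain ⟨y, hy₁, hy₂, hy⟩ := hA
    obtain ⟨x, hx₁, hxy, -, hg⟩ := hf.exists_relocate_before hy₁ hy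
    have g₁ : (relocate (f x) (f z₁) ∘ f) z₁ = f z₁ + 1 := by
      simp only [Function.comp_apply, relocate]; split_ifs <;> omega
    have g₂ : (relocate (f x) (f z₁) ∘ f) z₂ = f z₂ := by
      simp only [Function.comp_apply, relocate]; split_ifs <;> omega
    have g₃ : (relocate (f x) (f z₁) ∘ f) z₃ = f z₃ := by
      simp only [Function.comp_apply, relocate]; split_ifs <;> omega
    refine ⟨_, ⟨hg, by omega, by omega⟩,
      (false, ⟨f x - f z₁ - 1, by omega⟩, ⟨l - 1, by omega⟩), ?_⟩
    simp only [widenFirstGap, g₁, Bool.false_eq_true, if_false]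
    rw [if_pos (by omega)]
    exact relocate_comp_eq rfl (by omega) (by omega)
  push Not at hA
  obtain ⟨y, hy₁, hy₂, hy⟩ : ∃ y, f z₁ < f y ∧ f y < f z₂ ∧ ¬ y < z₂ := by
    by_contra! h
    have := hf.gap_le_gap he h12 fun w h₁ h₂ =>
      ⟨he.mono _ _ (hA w h₁ h₂), he.mono _ _ (h w h₁ h₂)⟩
    omega
  by_cases hB : ∃ w, f z₂ < f w ∧ f w < f z₃ ∧ ¬ w < z₃
  · obtain ⟨w, hw₁, hw₂, hw⟩ := hB
    obtain ⟨x, hx₁, hxw, -, hg⟩ := hf.exists_relocate_after hw₂ hw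
    have g₁ : (relocate (f x) (f z₃) ∘ f) z₁ = f z₁ := by
      simp only [Function.comp_apply, relocate]; split_ifs <;> omega
    have g₂ : (relocate (f x) (f z₃) ∘ f) z₂ = f z₂ := by
      simp only [Function.comp_apply, relocate]; split_ifs <;> omega
    have g₃ : (relocate (f x) (f z₃) ∘ f) z₃ = f z₃ - 1 := by
      simp only [Function.comp_apply, relocate]; split_ifs <;> omega
    have gy : (relocate (f x) (f z₃) ∘ f) y = f y := by
      simp only [Function.comp_apply, relocate]; split_ifs <;> omega
    set g := relocate (f x) (f z₃) ∘ f
    obtain ⟨v, hv₁, hyv, -, hh⟩ := hg.exists_relocate_after (z := z₂) (y := y) (by omega) hy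
    have h₁ : (relocate (g v) (g z₂) ∘ g) z₁ = f z₁ := by
      simp only [Function.comp_apply, relocate]; split_ifs <;> omega
    have h₂ : (relocate (g v) (g z₂) ∘ g) z₂ = f z₂ - 1 := by
      simp only [Function.comp_apply, relocate]; split_ifs <;> omega
    have h₃ : (relocate (g v) (g z₂) ∘ g) z₃ = f z₃ - 1 := by
      simp only [Function.comp_apply, relocate]; split_ifs <;> omega
    refine ⟨_, ⟨hh, by omega, by omega⟩,
      (true, ⟨g v - f z₁ - 1, by omega⟩, ⟨f x - f z₂ - 1, by omega⟩), ?_⟩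
    simp only [widenFirstGap, h₁, h₂, h₃, if_true]
    rw [if_neg (by omega)]
    exact relocate_relocate_comp_eq rfl (by omega) (by omega) (by omega) (by omega)
  push Not at hB
  by_cases hD : ∃ w, f z₁ < f w ∧ f w < f z₂ ∧ ¬ w < z₃
  · obtain ⟨w, hw₁, hw₂, hw⟩ := hD
    obtain ⟨x, hx₁, hxw, hx, hg⟩ := hf.exists_relocate_after (hw₂.trans (hf.mono _ _ h23)) hw
    have hx₂ : f x < f z₂ := by
      by_contra! h
      rcases h.eq_or_lt with h | h
      · exact hx (hf.inj h ▸ h23)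
      · exact hx (hB x h hx₁)
    have g₁ : (relocate (f x) (f z₃) ∘ f) z₁ = f z₁ := by
      simp only [Function.comp_apply, relocate]; split_ifs <;> omega
    have g₂ : (relocate (f x) (f z₃) ∘ f) z₂ = f z₂ - 1 := by
      simp only [Function.comp_apply, relocate]; split_ifs <;> omega
    have g₃ : (relocate (f x) (f z₃) ∘ f) z₃ = f z₃ - 1 := by
      simp only [Function.comp_apply, relocate]; split_ifs <;> omega
    refine ⟨_, ⟨hg, by omega, by omega⟩,
      (true, ⟨f x - f z₁ - 1, by omega⟩, ⟨l - 1, by omega⟩), ?_⟩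
    simp only [widenFirstGap, g₁, g₃, if_true]
    rw [if_pos (by omega)]
    exact relocate_comp_eq rfl (by omega) (by omega)
  push Not at hD
  obtain ⟨w, hw₁, hw₂, hw⟩ : ∃ w, f z₂ < f w ∧ f w < f z₃ ∧ ¬ z₁ < w := by
    by_contra! h
    have := hf.gap_le_gap he (h12.trans h23) fun w h₁ h₃ => by
      rcases lt_trichotomy (f w) (f z₂) with h' | h' | h'
      · exact ⟨he.mono _ _ (hA w h₁ h'), he.mono _ _ (hD w h₁ h')⟩
      · rw [hf.inj h']
        exact ⟨he.mono _ _ h12, he.mono _ _ h23⟩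
      · exact ⟨he.mono _ _ (h w h' h₃), he.mono _ _ (hB w h' h₃)⟩
    omega
  obtain ⟨x, hx₁, hxw, hx, hg⟩ := hf.exists_relocate_before ((hf.mono _ _ h12).trans hw₁) hw
  have hx₂ : f z₂ < f x := by
    by_contra! h
    rcases h.eq_or_lt with h | h
    · exact hx (hf.inj h ▸ h12)
    · exact hx (hA x hx₁ h)
  have g₁ : (relocate (f x) (f z₁) ∘ f) z₁ = f z₁ + 1 := by
    simp only [Function.comp_apply, relocate]; split_ifs <;> omega
  have g₂ : (relocate (f x) (f z₁) ∘ f) z₂ = f z₂ + 1 := by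
    simp only [Function.comp_apply, relocate]; split_ifs <;> omega
  have g₃ : (relocate (f x) (f z₁) ∘ f) z₃ = f z₃ := by
    simp only [Function.comp_apply, relocate]; split_ifs <;> omega
  have gy : (relocate (f x) (f z₁) ∘ f) y = f y + 1 := by
    simp only [Function.comp_apply, relocate]; split_ifs <;> omega
  set g := relocate (f x) (f z₁) ∘ f
  obtain ⟨v, hv₁, hyv, -, hh⟩ := hg.exists_relocate_after (z := z₂) (y := y) (by omega) hy
  have h₁ : (relocate (g v) (g z₂) ∘ g) z₁ = f z₁ + 1 := by
    simp only [Function.comp_apply, relocate]; split_ifs <;> omega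
  have h₂ : (relocate (g v) (g z₂) ∘ g) z₂ = f z₂ := by
    simp only [Function.comp_apply, relocate]; split_ifs <;> omega
  have h₃ : (relocate (g v) (g z₂) ∘ g) z₃ = f z₃ := by
    simp only [Function.comp_apply, relocate]; split_ifs <;> omega
  refine ⟨_, ⟨hh, by omega, by omega⟩,
    (false, ⟨g v - f z₁ - 2, by omega⟩, ⟨f x - f z₂ - 1, by omega⟩), ?_⟩
  simp only [widenFirstGap, h₁, h₂, Bool.false_eq_true, if_false]
  rw [if_neg (by omega)]
  exact relocate_relocate_comp_eq rfl (by omega) (by omega) (by omega) (by omega)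

/-- Undoes the relocations that lengthen the gap between `z₁` and `z₂`. -/
def narrowFirstGap (z₁ z₂ z₃ : X) (n l : ℕ) (g : X → ℕ) (c : Fin n × Fin (l + 1)) : X → ℕ :=
  if (c.1 : ℕ) ≤ g z₁ then relocate (g z₁ + 1) c.1 ∘ g
  else if (c.2 : ℕ) < l then relocate (g z₃ - 1) c.1 ∘ relocate (g z₂ - 1) (g z₂ + c.2) ∘ g
  else relocate (g z₂ - 1) c.1 ∘ g

lemma F_le_succ_left {z₁ z₂ z₃ : X} (h12 : z₁ < z₂) (h23 : z₂ < z₃) {k l : ℕ}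
    (hpos : 0 < F X z₁ z₂ z₃ (k + 1) (l + 1)) :
    F X z₁ z₂ z₃ k (l + 1) ≤
      Fintype.card X * (l + 1) * F X z₁ z₂ z₃ (k + 1) (l + 1) := by
  obtain ⟨e, he, he₂, he₃⟩ := exists_mem_gapSet hpos
  have hC : Nat.card (Fin (Fintype.card X) × Fin (l + 1)) = Fintype.card X * (l + 1) := by simp
  rw [← hC]
  refine F_le_card_mul (narrowFirstGap z₁ z₂ z₃ _ l) ?_
  rintro f ⟨hf, hf₂, hf₃⟩
  have hlt := hf.mono _ _ h12
  by_cases hA : ∃ y, f y < f z₁ ∧ ¬ y < z₁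
  · obtain ⟨y, hy₁, hy⟩ := hA
    obtain ⟨x, hx₁, -, -, hg⟩ := hf.exists_relocate_after hy₁ hy
    have g₁ : (relocate (f x) (f z₁) ∘ f) z₁ = f z₁ - 1 := by
      simp only [Function.comp_apply, relocate]; split_ifs <;> omega
    have g₂ : (relocate (f x) (f z₁) ∘ f) z₂ = f z₂ := by
      simp only [Function.comp_apply, relocate]; split_ifs <;> omega
    have g₃ : (relocate (f x) (f z₁) ∘ f) z₃ = f z₃ := by
      simp only [Function.comp_apply, relocate]; split_ifs <;> omega
    refine ⟨_, ⟨hg, by omega, by omega⟩, (⟨f x, hf.lt_card x⟩, 0), ?_⟩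
    simp only [narrowFirstGap, g₁]
    rw [if_pos (by omega)]
    exact relocate_comp_eq rfl rfl (by omega)
  push Not at hA
  obtain ⟨y, hy₂, hy⟩ : ∃ y, f z₂ < f y ∧ ¬ z₂ < y := by
    by_contra! h
    have := he.gap_le_gap hf h12 fun w h₁ h₂ => by
      constructor <;> by_contra! h'
      · rcases h'.eq_or_lt with h' | h'
        · rw [hf.inj h'] at h₁
          omega
        · have := he.mono _ _ (hA w h')
          omega
      · rcases h'.eq_or_lt with h' | h'
        · rw [hf.inj h'] at h₂
          omega
        · have := he.mono _ _ (h w h')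
          omega
    omega
  by_cases hB : ∃ y, f z₂ < f y ∧ f y < f z₃ ∧ ¬ z₂ < y
  · obtain ⟨y, hy₂, hy₃, hy⟩ := hB
    obtain ⟨w, hw₃, hw⟩ : ∃ w, f z₃ < f w ∧ ¬ z₃ < w := by
      by_contra! h
      have := he.gap_le_gap hf (h12.trans h23) fun w h₁ h₂ => by
        constructor <;> by_contra! h'
        · rcases h'.eq_or_lt with h' | h'
          · rw [hf.inj h'] at h₁
            omega
          · have := he.mono _ _ (hA w h')
            omega
        · rcases h'.eq_or_lt with h' | h'
          · rw [hf.inj h'] at h₂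
            omega
          · have := he.mono _ _ (h w h')
            omega
      omega
    obtain ⟨x, hx₁, hxw, -, hg⟩ := hf.exists_relocate_before hw₃ hw
    have g₁ : (relocate (f x) (f z₃) ∘ f) z₁ = f z₁ := by
      simp only [Function.comp_apply, relocate]; split_ifs <;> omega
    have g₂ : (relocate (f x) (f z₃) ∘ f) z₂ = f z₂ := by
      simp only [Function.comp_apply, relocate]; split_ifs <;> omega
    have g₃ : (relocate (f x) (f z₃) ∘ f) z₃ = f z₃ + 1 := by
      simp only [Function.comp_apply, relocate]; split_ifs <;> omega
    have gy : (relocate (f x) (f z₃) ∘ f) y = f y := by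
      simp only [Function.comp_apply, relocate]; split_ifs <;> omega
    set g := relocate (f x) (f z₃) ∘ f
    obtain ⟨v, hv₁, hyv, -, hh⟩ := hg.exists_relocate_before (z := z₂) (y := y) (by omega) hy
    have h₁ : (relocate (g v) (g z₂) ∘ g) z₁ = f z₁ := by
      simp only [Function.comp_apply, relocate]; split_ifs <;> omega
    have h₂ : (relocate (g v) (g z₂) ∘ g) z₂ = f z₂ + 1 := by
      simp only [Function.comp_apply, relocate]; split_ifs <;> omega
    have h₃ : (relocate (g v) (g z₂) ∘ g) z₃ = f z₃ + 1 := by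
      simp only [Function.comp_apply, relocate]; split_ifs <;> omega
    refine ⟨_, ⟨hh, by omega, by omega⟩,
      (⟨f x, hf.lt_card x⟩, ⟨g v - f z₂ - 1, by omega⟩), ?_⟩
    simp only [narrowFirstGap, h₁, h₂, h₃]
    rw [if_neg (by omega), if_pos (by omega)]
    exact relocate_relocate_comp_eq rfl rfl (by omega) (by omega) (by omega)
  push Not at hB
  obtain ⟨x, hx₂, -, hx, hg⟩ := hf.exists_relocate_before hy₂ hy
  have hx₃ : f z₃ < f x := by
    by_contra! h
    rcases h.eq_or_lt with h | h
    · exact hx (hf.inj h ▸ h23)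
    · exact hx (hB x hx₂ h)
  have g₁ : (relocate (f x) (f z₂) ∘ f) z₁ = f z₁ := by
    simp only [Function.comp_apply, relocate]; split_ifs <;> omega
  have g₂ : (relocate (f x) (f z₂) ∘ f) z₂ = f z₂ + 1 := by
    simp only [Function.comp_apply, relocate]; split_ifs <;> omega
  have g₃ : (relocate (f x) (f z₂) ∘ f) z₃ = f z₃ + 1 := by
    simp only [Function.comp_apply, relocate]; split_ifs <;> omega
  refine ⟨_, ⟨hg, by omega, by omega⟩, (⟨f x, hf.lt_card x⟩, ⟨l, by omega⟩), ?_⟩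
  simp only [narrowFirstGap, g₁, g₂]
  rw [if_neg (by omega), if_neg (by omega)]
  exact relocate_comp_eq rfl rfl (by omega)

lemma F_mul_F_le {z₁ z₂ z₃ : X} (h12 : z₁ < z₂) (h23 : z₂ < z₃) {k l : ℕ} (hl : 1 ≤ l)
    (hpos : 0 < F X z₁ z₂ z₃ k l * F X z₁ z₂ z₃ (k + 1) (l + 1)) :
    F X z₁ z₂ z₃ (k + 1) l * F X z₁ z₂ z₃ k (l + 1) ≤
      2 * k * l * (l + 1) * Fintype.card X *
        (F X z₁ z₂ z₃ k l * F X z₁ z₂ z₃ (k + 1) (l + 1)) := by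
  refine (Nat.mul_le_mul (F_succ_left_le h12 h23 hl (Nat.pos_of_mul_pos_right hpos))
    (F_le_succ_left h12 h23 (Nat.pos_of_mul_pos_left hpos))).trans_eq ?_
  ring

/-- Reversing the order exchanges the two gaps. -/
lemma F_orderDual (z₁ z₂ z₃ : X) (k l : ℕ) :
    F Xᵒᵈ (OrderDual.toDual z₃) (OrderDual.toDual z₂) (OrderDual.toDual z₁) l k =
      F X z₁ z₂ z₃ k l := by
  refine Nat.card_congr (Equiv.subtypeEquiv
    (Equiv.equivCongr OrderDual.ofDual Fin.revPerm) fun L => ?_)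
  change ((∀ a b : X, b < a → L (OrderDual.toDual a) < L (OrderDual.toDual b)) ∧ _ ∧ _) ↔
    ((∀ a b : X, a < b → (L (OrderDual.toDual a)).rev < (L (OrderDual.toDual b)).rev) ∧
      ((L (OrderDual.toDual z₂)).rev : ℕ) = (L (OrderDual.toDual z₁)).rev + k ∧
      ((L (OrderDual.toDual z₃)).rev : ℕ) = (L (OrderDual.toDual z₂)).rev + l)
  have h₁ := (L (OrderDual.toDual z₁)).2
  have h₂ := (L (OrderDual.toDual z₂)).2
  have h₃ := (L (OrderDual.toDual z₃)).2
  simp only [Fin.rev_lt_rev, Fin.val_rev]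
  refine and_congr forall_comm ?_
  omega

end

theorem converse_cross_product (X : Type) [PartialOrder X] [Fintype X]
    (n : ℕ) (hn : Fintype.card X = n)
    (z₁ z₂ z₃ : X) (h12 : z₁ < z₂) (h23 : z₂ < z₃)
    (k l : ℕ) (hk : 1 ≤ k) (hl : 1 ≤ l)
    (hpos : 0 < F X z₁ z₂ z₃ k l * F X z₁ z₂ z₃ (k + 1) (l + 1)) :
    F X z₁ z₂ z₃ (k + 1) l * F X z₁ z₂ z₃ k (l + 1) ≤
      2 * k * l * (min k l + 1) * n * (F X z₁ z₂ z₃ k l * F X z₁ z₂ z₃ (k + 1) (l + 1)) := by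
  subst hn
  rcases le_total l k with h | h
  · rw [min_eq_right h]
    exact F_mul_F_le h12 h23 hl hpos
  · rw [min_eq_left h]
    have := F_mul_F_le (X := Xᵒᵈ) (z₁ := OrderDual.toDual z₃) (z₂ := OrderDual.toDual z₂)
      (z₃ := OrderDual.toDual z₁) h23 h12 hk (k := l) (by simpa only [F_orderDual] using hpos)
    simp only [F_orderDual, Fintype.card_orderDual] at this
    refine (mul_comm _ _).trans_le (this.trans_eq ?_)
    ring
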